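/- Let H be a Hopf algebra with an algebra filtration H⁰ ⊆ H¹ ⊆ … ⊆ H^m = H satisfying Δ(Hⁿ) ⊆ Σ_{i=0}^{n} H^i ⊗ H^{n-i}, and let (A,λ) be a left H-comodule algebra. Define Aⁿ = λ^{-1}(Hⁿ ⊗ A) for n = 0,…,m. Then A⁰ ⊆ A¹ ⊆ … ⊆ A^m = A is an algebra filtration of A such that λ(Aⁿ) ⊆ Σ_{i=0}^{n} H^i ⊗ A^{n-i} for each n, i.e. a comodule algebra filtration compatible with the given filtration of H. -/

import Mathlib

open TensorProduct

noncomputable section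

namespace HopfPaper

variable (k : Type) [CommRing k]

/-- The image submodule `p ⊗ q ⊆ M ⊗ N` of a pair of submodules. -/
def tsub {M N : Type} [AddCommGroup M] [Module k M] [AddCommGroup N] [Module k N]
    (p : Submodule k M) (q : Submodule k N) : Submodule k (M ⊗[k] N) :=
  LinearMap.range (TensorProduct.mapIncl p q)

/-- A left `H`-comodule algebra structure on the `k`-algebra `A`:
an algebra map `λ : A → H ⊗ A` which is coassociative and counital. -/
structure ComodAlg (H A : Type) [Ring H] [HopfAlgebra k H] [Ring A] [Algebra k A] where
  lam : A →ₐ[k] H ⊗[k] A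
  coassoc : (Coalgebra.comul (R := k) (A := H)).rTensor A ∘ₗ lam.toLinearMap
      = (TensorProduct.assoc k H H A).symm.toLinearMap ∘ₗ
          lam.toLinearMap.lTensor H ∘ₗ lam.toLinearMap
  counital : (Coalgebra.counit (R := k) (A := H)).rTensor A ∘ₗ lam.toLinearMap
      = TensorProduct.mk k k A 1

variable {k}

/-- A right ideal of `A` which is costable under the coaction, i.e. `λ(J) ⊆ H ⊗ J`. -/
def ComodAlg.IsCostableRightIdeal {H A : Type} [Ring H] [HopfAlgebra k H] [Ring A] [Algebra k A]
    (c : ComodAlg k H A) (J : Submodule k A) : Prop :=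
  (∀ j ∈ J, ∀ a : A, j * a ∈ J) ∧
    Submodule.map c.lam.toLinearMap J ≤ tsub k (⊤ : Submodule k H) J

/-- `A` is right `H`-simple: it has no nontrivial `H`-costable right ideal. -/
def ComodAlg.RightSimple {H A : Type} [Ring H] [HopfAlgebra k H] [Ring A] [Algebra k A]
    (c : ComodAlg k H A) : Prop :=
  ∀ J : Submodule k A, c.IsCostableRightIdeal J → J = ⊥ ∨ J = ⊤

/-- The coinvariants of `A` are trivial: `A^{co H} = k`. -/
def ComodAlg.TrivialCoinv {H A : Type} [Ring H] [HopfAlgebra k H] [Ring A] [Algebra k A]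
    (c : ComodAlg k H A) : Prop :=
  ∀ a : A, c.lam a = 1 ⊗ₜ[k] a ↔ ∃ t : k, a = t • (1 : A)

end HopfPaper

namespace HopfPaper

theorem tmul_mem_tsub {k M N : Type} [CommRing k] [AddCommGroup M] [Module k M]
    [AddCommGroup N] [Module k N] {p : Submodule k M} {q : Submodule k N} {a : M} {b : N}
    (ha : a ∈ p) (hb : b ∈ q) : a ⊗ₜ[k] b ∈ tsub k p q :=
  ⟨(⟨a, ha⟩ : p) ⊗ₜ (⟨b, hb⟩ : q), rfl⟩

theorem tsub_le {k M N : Type} [CommRing k] [AddCommGroup M] [Module k M]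
    [AddCommGroup N] [Module k N] {p : Submodule k M} {q : Submodule k N}
    {S : Submodule k (M ⊗[k] N)} (h : ∀ a ∈ p, ∀ b ∈ q, a ⊗ₜ[k] b ∈ S) : tsub k p q ≤ S := by
  rintro _ ⟨z, rfl⟩
  induction z with
  | zero => simp
  | tmul a b => exact h a a.2 b b.2
  | add x y hx hy => rw [map_add]; exact S.add_mem hx hy

theorem tsub_mono {k M N : Type} [CommRing k] [AddCommGroup M] [Module k M]
    [AddCommGroup N] [Module k N] {p p' : Submodule k M} {q q' : Submodule k N}
    (hp : p ≤ p') (hq : q ≤ q') : tsub k p q ≤ tsub k p' q' :=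
  tsub_le fun _ ha _ hb => tmul_mem_tsub (hp ha) (hq hb)

theorem tsub_top_top {k M N : Type} [CommRing k] [AddCommGroup M] [Module k M]
    [AddCommGroup N] [Module k N] : tsub k (⊤ : Submodule k M) (⊤ : Submodule k N) = ⊤ := by
  refine eq_top_iff.2 fun x _ => ?_
  induction x with
  | zero => simp
  | tmul a b => exact tmul_mem_tsub trivial trivial
  | add x y hx hy => exact add_mem (hx trivial) (hy trivial)

theorem tsub_mul_tsub_le {k H A : Type} [CommRing k] [Ring H] [Algebra k H] [Ring A]
    [Algebra k A] (p p' : Submodule k H) (q q' : Submodule k A) :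
    tsub k p q * tsub k p' q' ≤ tsub k (p * p') (q * q') := by
  refine Submodule.mul_le.2 fun x hx y hy => ?_
  have hxS : tsub k p q ≤ (tsub k (p * p') (q * q')).comap (LinearMap.mulRight k y) := by
    refine tsub_le fun a ha b hb => ?_
    have hyS : tsub k p' q' ≤
        (tsub k (p * p') (q * q')).comap (LinearMap.mulLeft k (a ⊗ₜ[k] b)) := by
      refine tsub_le fun a' ha' b' hb' => ?_
      simpa using tmul_mem_tsub (Submodule.mul_mem_mul ha ha') (Submodule.mul_mem_mul hb hb')
    exact hyS hy
  exact hxS hx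

/-- Contraction of the left tensor factor with a linear functional. -/
def contractLeft {k M : Type} [CommRing k] [AddCommGroup M] [Module k M]
    (N : Type) [AddCommGroup N] [Module k N] (f : M →ₗ[k] k) : M ⊗[k] N →ₗ[k] N :=
  (TensorProduct.lid k N).toLinearMap ∘ₗ f.rTensor N

@[simp]
theorem contractLeft_tmul {k M N : Type} [CommRing k] [AddCommGroup M] [Module k M]
    [AddCommGroup N] [Module k N] (f : M →ₗ[k] k) (a : M) (b : N) :
    contractLeft N f (a ⊗ₜ[k] b) = f a • b := by
  simp [contractLeft]

theorem contractLeft_lTensor {k M N P : Type} [CommRing k] [AddCommGroup M] [Module k M]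
    [AddCommGroup N] [Module k N] [AddCommGroup P] [Module k P] (f : M →ₗ[k] k)
    (g : N →ₗ[k] P) (x : M ⊗[k] N) :
    contractLeft P f (g.lTensor M x) = g (contractLeft N f x) := by
  induction x with
  | zero => simp
  | tmul a b => simp
  | add x y hx hy => simp [hx, hy]

theorem contractLeft_rTensor {k M M' N : Type} [CommRing k] [AddCommGroup M] [Module k M]
    [AddCommGroup M'] [Module k M'] [AddCommGroup N] [Module k N] (f : M' →ₗ[k] k)
    (g : M →ₗ[k] M') (x : M ⊗[k] N) :
    contractLeft N f (g.rTensor N x) = contractLeft N (f ∘ₗ g) x := by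
  induction x with
  | zero => simp
  | tmul a b => simp
  | add x y hx hy => simp [hx, hy]

theorem exists_retraction {k M : Type} [Field k] [AddCommGroup M] [Module k M]
    (p : Submodule k M) : ∃ r : M →ₗ[k] p, ∀ a : p, r a = a := by
  obtain ⟨r, hr⟩ := p.subtype.exists_leftInverse_of_injective p.ker_subtype
  exact ⟨r, fun a => LinearMap.congr_fun hr a⟩

theorem mem_tsub_of_contractLeft_mem {k M N : Type} [Field k] [AddCommGroup M] [Module k M]
    [AddCommGroup N] [Module k N] {p : Submodule k M} {q : Submodule k N} {x : M ⊗[k] N}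
    (hx : x ∈ tsub k p ⊤) (h : ∀ f : M →ₗ[k] k, contractLeft N f x ∈ q) : x ∈ tsub k p q := by
  classical
  obtain ⟨r, hr⟩ := exists_retraction p
  let b := Module.Basis.ofVectorSpace k p
  obtain ⟨z, rfl⟩ := hx
  obtain ⟨c, rfl⟩ := TensorProduct.eq_repr_basis_left b z
  simp only [Finsupp.sum, map_sum] at h ⊢
  refine Submodule.sum_mem _ fun i hi => ?_
  have hci := h (b.coord i ∘ₗ r)
  have : ((c i : (⊤ : Submodule k N)) : N) ∈ q := by
    simpa [TensorProduct.mapIncl, hr, Finsupp.single_apply, Finsupp.mem_support_iff.1 hi] using hci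
  exact tmul_mem_tsub (b i).2 this

theorem exists_adapted_projection {k M : Type} [Field k] [AddCommGroup M] [Module k M]
    {p q : Submodule k M} (hpq : p ≤ q) : ∃ e : M →ₗ[k] M,
      (∀ a ∈ p, e a = 0) ∧ (∀ a, e a ∈ q) ∧ ∀ a ∈ q, a - e a ∈ p := by
  obtain ⟨r, hr⟩ := exists_retraction p
  obtain ⟨s, hs⟩ := exists_retraction q
  have hs' : ∀ a ∈ q, (s a : M) = a := fun a ha => congrArg Subtype.val (hs ⟨a, ha⟩)
  have hr' : ∀ a ∈ p, (r a : M) = a := fun a ha => congrArg Subtype.val (hr ⟨a, ha⟩)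
  refine ⟨(LinearMap.id - p.subtype ∘ₗ r) ∘ₗ q.subtype ∘ₗ s, fun a ha => ?_, fun a => ?_,
    fun a ha => ?_⟩
  · simp [hs' a (hpq ha), hr' a ha]
  · simpa using q.sub_mem (s a).2 (hpq (r (s a)).2)
  · simp [hs' a ha]

theorem mem_iSup_tsub_of_contractLeft_mem {k M N : Type} [Field k] [AddCommGroup M]
    [Module k M] [AddCommGroup N] [Module k N] {E : ℕ → Submodule k M} (hE : Monotone E)
    (hE0 : E 0 = ⊥) (K : ℕ → Submodule k N) (n : ℕ) (x : M ⊗[k] N) (hx : x ∈ tsub k (E n) ⊤)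
    (h : ∀ i < n, ∀ f : M →ₗ[k] k, (∀ a ∈ E i, f a = 0) → contractLeft N f x ∈ K i) :
    x ∈ ⨆ i ∈ Finset.range n, tsub k (E (i + 1)) (K i) := by
  induction n generalizing x with
  | zero =>
    have : tsub k (E 0) (⊤ : Submodule k N) ≤ ⊥ := tsub_le fun a ha b _ => by
      rw [hE0, Submodule.mem_bot] at ha
      simp [ha]
    exact bot_le (a := (⨆ i ∈ Finset.range 0, tsub k (E (i + 1)) (K i))) (this hx)
  | succ n ih =>
    obtain ⟨e, he0, heq, hep⟩ := exists_adapted_projection (hE n.le_succ)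
    have hlow : x - e.rTensor N x ∈ tsub k (E n) ⊤ := by
      have : tsub k (E (n + 1)) (⊤ : Submodule k N) ≤
          (tsub k (E n) ⊤).comap (LinearMap.id - e.rTensor N) := tsub_le fun a ha b hb => by
        simpa [← TensorProduct.sub_tmul] using tmul_mem_tsub (hep a ha) hb
      exact this hx
    have hhigh : e.rTensor N x ∈ tsub k (E (n + 1)) (K n) := by
      refine mem_tsub_of_contractLeft_mem ?_ fun f => ?_
      · have : tsub k (E (n + 1)) (⊤ : Submodule k N) ≤
            (tsub k (E (n + 1)) ⊤).comap (e.rTensor N) := tsub_le fun a _ b hb =>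
          tmul_mem_tsub (heq a) hb
        exact this hx
      · rw [contractLeft_rTensor]
        exact h n n.lt_succ_self _ fun a ha => by simp [he0 a ha]
    have hrec := ih (x - e.rTensor N x) hlow fun i hi f hf => by
      rw [map_sub, contractLeft_rTensor]
      exact (K i).sub_mem (h i (hi.trans n.lt_succ_self) f hf)
        (h i (hi.trans n.lt_succ_self) _ fun a ha => by simp [he0 a (hE hi.le ha)])
    rw [← sub_add_cancel x (e.rTensor N x)]
    have hmono : ⨆ i ∈ Finset.range n, tsub k (E (i + 1)) (K i) ≤
        ⨆ i ∈ Finset.range (n + 1), tsub k (E (i + 1)) (K i) :=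
      biSup_mono fun i hi => Finset.range_mono n.le_succ hi
    exact add_mem (hmono hrec)
      (le_biSup (fun i => tsub k (E (i + 1)) (K i)) (Finset.self_mem_range_succ n) hhigh)

theorem contractLeft_mem_of_mem_iSup_tsub {k M N : Type} [CommRing k] [AddCommGroup M]
    [Module k M] [AddCommGroup N] [Module k N] {F : ℕ → Submodule k M}
    {K : ℕ → Submodule k N} (hK : Antitone K) {n i : ℕ} {x : M ⊗[k] N}
    (hx : x ∈ ⨆ j ∈ Finset.range n, tsub k (F j) (K j)) {f : M →ₗ[k] k}
    (hf : ∀ j < i, ∀ a ∈ F j, f a = 0) : contractLeft N f x ∈ K i := by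
  have : ⨆ j ∈ Finset.range n, tsub k (F j) (K j) ≤ (K i).comap (contractLeft N f) := by
    refine iSup₂_le fun j _ => tsub_le fun a ha b hb => ?_
    rw [Submodule.mem_comap, contractLeft_tmul]
    rcases lt_or_ge j i with hji | hij
    · simp [hf j hji a ha]
    · exact (K i).smul_mem _ (hK hij hb)
  exact this hx

theorem assoc_rTensor_mem_iSup_tsub {k H C A : Type} [CommRing k] [AddCommGroup H] [Module k H]
    [AddCommGroup C] [Module k C] [AddCommGroup A] [Module k A] {δ : C →ₗ[k] H ⊗[k] H}
    {F G : ℕ → Submodule k H} {S : Submodule k C} {n : ℕ}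
    (hδ : S.map δ ≤ ⨆ i ∈ Finset.range n, tsub k (F i) (G i))
    {x : C ⊗[k] A} (hx : x ∈ tsub k S ⊤) :
    TensorProduct.assoc k H H A (δ.rTensor A x) ∈
      ⨆ i ∈ Finset.range n, tsub k (F i) (tsub k (G i) (⊤ : Submodule k A)) := by
  set T := ⨆ i ∈ Finset.range n, tsub k (F i) (tsub k (G i) (⊤ : Submodule k A))
  have : tsub k S (⊤ : Submodule k A) ≤
      T.comap ((TensorProduct.assoc k H H A).toLinearMap ∘ₗ δ.rTensor A) := by
    refine tsub_le fun a ha b _ => ?_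
    have hle : ⨆ i ∈ Finset.range n, tsub k (F i) (G i) ≤
        T.comap ((TensorProduct.assoc k H H A).toLinearMap ∘ₗ
          (TensorProduct.mk k (H ⊗[k] H) A).flip b) := by
      refine iSup₂_le fun i hi => tsub_le fun u hu v hv => ?_
      exact le_biSup (fun i => tsub k (F i) (tsub k (G i) (⊤ : Submodule k A))) hi
        (tmul_mem_tsub hu (tmul_mem_tsub hv trivial))
    exact hle (hδ (Submodule.mem_map_of_mem ha))
  exact this hx

/-- **Statement 1** (Lemma `induced-filt`).
Let `H` be a Hopf algebra with an algebra filtration `H⁰ ⊆ H¹ ⊆ … ⊆ H^m = H` satisfying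
`Δ(Hⁿ) ⊆ Σ_{i≤n} H^i ⊗ H^{n-i}`, and let `(A,λ)` be a left `H`-comodule algebra.  Define
`Aⁿ = λ⁻¹(Hⁿ ⊗ A)`.  Then `A⁰ ⊆ … ⊆ A^m = A` is an algebra filtration of `A` with
`λ(Aⁿ) ⊆ Σ_{i≤n} H^i ⊗ A^{n-i}`, i.e. a comodule algebra filtration compatible with the
filtration of `H`. -/
theorem stmt_1 (k : Type) [Field k] (H : Type) [Ring H] [HopfAlgebra k H]
    (m : ℕ) (F : ℕ → Submodule k H)
    (hmono : Monotone F) (htop : F m = ⊤)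
    (hone : (1 : H) ∈ F 0) (hmul : ∀ i j, F i * F j ≤ F (i + j))
    (hcomul : ∀ n, Submodule.map (Coalgebra.comul (R := k) (A := H)) (F n)
      ≤ ⨆ i ∈ Finset.range (n + 1), tsub k (F i) (F (n - i)))
    (A : Type) [Ring A] [Algebra k A] (c : ComodAlg k H A)
    (FA : ℕ → Submodule k A)
    (hFA : ∀ n, FA n = Submodule.comap c.lam.toLinearMap (tsub k (F n) (⊤ : Submodule k A))) :
    Monotone FA ∧ FA m = ⊤ ∧ (1 : A) ∈ FA 0 ∧ (∀ i j, FA i * FA j ≤ FA (i + j)) ∧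
      ∀ n, Submodule.map c.lam.toLinearMap (FA n)
        ≤ ⨆ i ∈ Finset.range (n + 1), tsub k (F i) (FA (n - i)) := by
  have hmonoA : Monotone FA := fun i j hij => by
    rw [hFA, hFA]
    exact Submodule.comap_mono (tsub_mono (hmono hij) le_rfl)
  refine ⟨hmonoA, ?_, ?_, fun i j => ?_, fun n => ?_⟩
  · rw [hFA, htop, tsub_top_top, Submodule.comap_top]
  · rw [hFA, Submodule.mem_comap, AlgHom.toLinearMap_apply, map_one]
    exact tmul_mem_tsub hone trivial
  · refine Submodule.mul_le.2 fun a ha b hb => ?_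
    rw [hFA, Submodule.mem_comap, AlgHom.toLinearMap_apply] at *
    rw [map_mul]
    exact tsub_mono (hmul i j) le_top (tsub_mul_tsub_le _ _ _ _ (Submodule.mul_mem_mul ha hb))
  · rintro _ ⟨a, ha, rfl⟩
    rw [SetLike.mem_coe, hFA, Submodule.mem_comap] at ha
    have hmem := assoc_rTensor_mem_iSup_tsub (hcomul n) ha
    have hco := LinearMap.congr_fun c.coassoc a
    simp only [LinearMap.comp_apply, LinearEquiv.coe_coe] at hco
    rw [hco, LinearEquiv.apply_symm_apply] at hmem
    let E : ℕ → Submodule k H := fun i => Nat.casesOn i ⊥ F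
    have hE : Monotone E := monotone_nat_of_le_succ fun i => by
      cases i with
      | zero => exact bot_le
      | succ i => exact hmono i.le_succ
    refine mem_iSup_tsub_of_contractLeft_mem hE rfl (fun i => FA (n - i)) (n + 1) _ ha
      fun i _ f hf => ?_
    rw [hFA, Submodule.mem_comap, ← contractLeft_lTensor]
    refine contractLeft_mem_of_mem_iSup_tsub (K := fun i => tsub k (F (n - i)) ⊤)
      (fun i j hij => tsub_mono (hmono (Nat.sub_le_sub_left hij n)) le_rfl) hmem
      fun j hji b hb => hf b (hE (Nat.succ_le_of_lt hji) hb)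

end HopfPaper
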